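/- arXiv:2102.11443 — 3 statements merged into one kernel-verified Lean document; each statement's English description precedes it below -/
import Mathlib

section
/- Let 𝓜 = (M_j)_{j∈J} be a family of abelian groups, M = ∏_{j∈J} M_j its direct product and S = ⊕_{j∈J} M_j its direct sum. The following are equivalent: (1) M is self-small; (2) M is S-small; (3) M is ⊕𝒞-small for every countable subfamily 𝒞 of 𝓜. -/
/-- `A` is `B`-small: for every index set `I`, every homomorphism `A → B^{(I)}`
has image contained in `B^{(F)}` for some finite `F ⊆ I`. -/
def IsBSmall (A : Type*) (B : Type*) [AddCommGroup A] [AddCommGroup B] : Prop :=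
  ∀ (I : Type) (f : A →+ Π₀ _ : I, B), ∃ F : Finset I, ∀ (a : A) (i : I), i ∉ F → f a i = 0

/-- `A` is self-small if `A` is `A`-small. -/
def IsSelfSmall (A : Type*) [AddCommGroup A] : Prop := IsBSmall A A

/-- Smallness passes to a group that embeds into the target. -/
lemma IsBSmall.of_injective {A B B' : Type*} [AddCommGroup A] [AddCommGroup B] [AddCommGroup B']
    (h : IsBSmall A B') (φ : B →+ B') (hφ : Function.Injective φ) : IsBSmall A B := by
  intro I f
  obtain ⟨F, hF⟩ := h I ((DFinsupp.mapRange.addMonoidHom fun _ => φ).comp f)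
  exact ⟨F, fun a i hi => (map_eq_zero_iff φ hφ).mp (by simpa using hF a i hi)⟩

/-- Restriction of a finitely supported function along an injective map, as a homomorphism. -/
noncomputable def DFinsupp.comapDomainAddMonoidHom {I K : Type*} (B : I → Type*)
    [∀ i, AddCommGroup (B i)] (e : K → I) (he : Function.Injective e) : (Π₀ i, B i) →+ Π₀ k, B (e k) where
  toFun f := f.comapDomain e he
  map_zero' := DFinsupp.comapDomain_zero e he
  map_add' f g := DFinsupp.comapDomain_add e he f g

/-- The direct sum of a subfamily embeds into the direct sum of the whole family. -/
lemma exists_injective_directSum_subtype {J : Type*} (M : J → Type*) [∀ j, AddCommGroup (M j)]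
    (C : Set J) :
    ∃ φ : (Π₀ c : C, M c.val) →+ Π₀ j, M j, Function.Injective φ := by
  classical
  let φ : (Π₀ c : C, M c.val) →+ Π₀ j, M j :=
    DFinsupp.liftAddHom fun c : C => DFinsupp.singleAddHom M c.val
  let ρ := DFinsupp.comapDomainAddMonoidHom M (Subtype.val : C → J) Subtype.val_injective
  have hρφ : ρ.comp φ = AddMonoidHom.id _ := by
    refine DFinsupp.addHom_ext fun c x => ?_
    simp [φ, ρ, DFinsupp.comapDomainAddMonoidHom]
  exact ⟨φ, Function.LeftInverse.injective (g := ρ) fun x => DFunLike.congr_fun hρφ x⟩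

/-- If `A` is small for the direct sum of every countable subfamily, then it is small for the
direct product of the whole family. -/
lemma IsBSmall.pi_of_countable {A J : Type*} [AddCommGroup A] {M : J → Type*}
    [∀ j, AddCommGroup (M j)]
    (h : ∀ C : Set J, C.Countable → IsBSmall A (Π₀ c : C, M c.val)) :
    IsBSmall A (∀ j, M j) := by
  classical
  intro I f
  by_cases hT : {i | ∃ a, f a i ≠ 0}.Finite
  · refine ⟨hT.toFinset, fun a i hi => ?_⟩
    by_contra hne
    exact hi (hT.mem_toFinset.mpr ⟨a, hne⟩)
  · let e := Set.Infinite.natEmbedding _ hT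
    have he : Function.Injective fun n => (e n).val := Subtype.val_injective.comp e.injective
    have hne (n : ℕ) : ∃ a j, f a (e n).val j ≠ 0 := by
      obtain ⟨a, ha⟩ := (e n).property
      exact ⟨a, Function.ne_iff.mp ha⟩
    choose a j haj using hne
    let p (n : ℕ) : (∀ j, M j) →+ Π₀ c : Set.range j, M c.val :=
      (DFinsupp.singleAddHom (fun c : Set.range j => M c.val) ⟨j n, n, rfl⟩).comp
        (Pi.evalAddMonoidHom M (j n))
    obtain ⟨F, hF⟩ := h (Set.range j) (Set.countable_range j) ℕ
      (((DFinsupp.mapRange.addMonoidHom p).comp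
        (DFinsupp.comapDomainAddMonoidHom (fun _ : I => ∀ j, M j) _ he)).comp f)
    obtain ⟨n, hn⟩ := Infinite.exists_notMem_finset F
    have hz := hF (a n) n hn
    simp only [AddMonoidHom.comp_apply, DFinsupp.mapRange.addMonoidHom_apply,
      DFinsupp.mapRange_apply, DFinsupp.comapDomainAddMonoidHom, AddMonoidHom.coe_mk,
      ZeroHom.coe_mk, DFinsupp.comapDomain_apply, p, DFinsupp.singleAddHom_apply,
      Pi.evalAddMonoidHom_apply, DFinsupp.single_eq_zero] at hz
    exact (haj n hz).elim

/-- For a family `𝓜 = (M j)_{j ∈ J}` of abelian groups with direct product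
`M = ∏_{j} M j` and direct sum `S = ⊕_{j} M j`, the following are equivalent:
(1) `M` is self-small; (2) `M` is `S`-small; (3) `M` is `⊕𝒞`-small for every countable
subfamily `𝒞 ⊆ 𝓜`. -/
theorem product_selfSmall_tfae (J : Type) (M : J → Type) [∀ j, AddCommGroup (M j)] :
    List.TFAE
      [ IsSelfSmall (∀ j, M j),
        IsBSmall (∀ j, M j) (Π₀ j, M j),
        ∀ C : Set J, C.Countable → IsBSmall (∀ j, M j) (Π₀ c : C, M c.val) ] := by
  tfae_have 1 → 2 := fun h =>
    IsBSmall.of_injective h DFinsupp.coeFnAddMonoidHom DFunLike.coe_injective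
  tfae_have 2 → 3 := fun h C _ =>
    have ⟨φ, hφ⟩ := exists_injective_directSum_subtype M C
    h.of_injective φ hφ
  tfae_have 3 → 1 := IsBSmall.pi_of_countable
  tfae_finish
end

section
/- Let A be an abelian group and I a set. Then the direct product A^{I} is self-small if and only if A^{I} is A-small. -/
/-- Smallness relative to `C` descends to any `B` embedding into `C`. -/
theorem IsBSmall.of_injective_s15 {P B C : Type*} [AddCommGroup P] [AddCommGroup B] [AddCommGroup C]
    (h : IsBSmall P C) (e : B →+ C) (he : Function.Injective e) : IsBSmall P B := by
  intro J f
  obtain ⟨F, hF⟩ := h J ((DFinsupp.mapRange.addMonoidHom fun _ => e).comp f)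
  refine ⟨F, fun a j hj => he ?_⟩
  simpa using hF a j hj

/-- Smallness relative to `B` passes to all powers of `B`: a nonzero component of a map into a
direct sum of powers stays nonzero after a suitable coordinate projection. -/
theorem IsBSmall.pi {P B : Type*} [AddCommGroup P] [AddCommGroup B]
    (h : IsBSmall P B) (I : Type*) : IsBSmall P (I → B) := by
  intro J f
  rcases isEmpty_or_nonempty I with _ | _
  · exact ⟨∅, fun a j _ => Subsingleton.elim _ _⟩
  have key : ∀ j, ∃ i, (∀ a, f a j i = 0) → ∀ a, f a j = 0 := by
    intro j
    by_cases hj : ∀ a, f a j = 0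
    · exact ⟨Classical.arbitrary I, fun _ => hj⟩
    · push Not at hj
      obtain ⟨a, ha⟩ := hj
      obtain ⟨i, hi⟩ := Function.ne_iff.mp ha
      exact ⟨i, fun hz => absurd (hz a) hi⟩
  choose i hi using key
  obtain ⟨F, hF⟩ := h J
    ((DFinsupp.mapRange.addMonoidHom fun j => Pi.evalAddMonoidHom (fun _ : I => B) (i j)).comp f)
  refine ⟨F, fun a j hj => hi j (fun b => ?_) a⟩
  simpa using hF b j hj

/-- For an abelian group `A` and a set `I`, the direct product `A^I` is
self-small if and only if `A^I` is `A`-small. -/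
theorem pow_selfSmall_iff (A : Type) [AddCommGroup A] (I : Type) :
    IsSelfSmall (I → A) ↔ IsBSmall (I → A) A := by
  refine ⟨fun h => ?_, fun h => h.pi I⟩
  rcases isEmpty_or_nonempty I with _ | _
  · intro J f
    refine ⟨∅, fun a j _ => ?_⟩
    rw [Subsingleton.elim a 0, map_zero, DFinsupp.zero_apply]
  · exact IsBSmall.of_injective_s15 h (Pi.constAddMonoidHom I A) (Function.const_injective)
end

section
/- Let p be a prime, P a nonzero abelian p-group, R a nonzero torsion abelian group, and κ a cardinal. Then: (1) the direct product (ℤ/pℤ)^{κ} of κ copies of the cyclic group ℤ/pℤ is P-small if and only if κ is finite; (2) the direct product ℤ^{κ} of κ copies of ℤ is R-small if and only if κ is finite. -/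
/-- A finitely generated group is small with respect to every group. -/
theorem IsBSmall.of_fg {A B : Type*} [AddCommGroup A] [AddCommGroup B] (hA : AddGroup.FG A) :
    IsBSmall A B := by
  classical
  intro I f
  obtain ⟨S, hS⟩ := hA.out
  refine ⟨S.biUnion fun s => (f s).support, fun a i hi => ?_⟩
  have ha : a ∈ AddSubgroup.closure (S : Set A) := hS ▸ AddSubgroup.mem_top a
  induction ha using AddSubgroup.closure_induction with
  | mem x hx =>
    by_contra h
    exact hi (Finset.mem_biUnion.2 ⟨x, hx, DFinsupp.mem_support_iff.2 h⟩)
  | zero => simp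
  | add x y _ _ hx hy => simp [hx, hy]
  | neg x _ hx => simp [hx]

/-- Smallness passes to quotients. -/
theorem IsBSmall.of_surjective {A A' B : Type*} [AddCommGroup A] [AddCommGroup A']
    [AddCommGroup B] (h : IsBSmall A B) (g : A →+ A') (hg : Function.Surjective g) :
    IsBSmall A' B := by
  intro I f
  obtain ⟨F, hF⟩ := h I (f.comp g)
  refine ⟨F, fun a i hi => ?_⟩
  obtain ⟨a, rfl⟩ := hg a
  exact hF a i hi

/-- A vector space over `ℤ/pℤ` which is small with respect to a group having an element of
order `p` is finite-dimensional. -/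
theorem IsBSmall.finite_of_addOrderOf_eq {p : ℕ} [Fact p.Prime] {V : Type} {B : Type*}
    [AddCommGroup V] [Module (ZMod p) V] [AddCommGroup B] (h : IsBSmall V B) {b : B}
    (hb : addOrderOf b = p) : Module.Finite (ZMod p) V := by
  classical
  let v := Module.Basis.ofVectorSpace (ZMod p) V
  let e : ZMod p →+ B := ZMod.lift p ⟨zmultiplesHom B b, by simp [← hb]⟩
  have he : e 1 ≠ 0 := by
    have h1 : e 1 = b := by
      simpa using ZMod.lift_coe p ⟨zmultiplesHom B b, by simp [← hb]⟩ 1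
    rw [h1, Ne, ← AddMonoid.addOrderOf_eq_one_iff, hb]
    exact (Fact.out : p.Prime).ne_one
  obtain ⟨F, hF⟩ := h _ (((DFinsupp.mapRange.addMonoidHom fun _ => e).comp
    (finsuppAddEquivDFinsupp.toAddMonoidHom)).comp v.repr.toAddEquiv.toAddMonoidHom)
  have hmem : ∀ i, i ∈ F := by
    intro i
    by_contra hi
    exact he (by simpa using hF (v i) i hi)
  have : Fintype (Module.Basis.ofVectorSpaceIndex (ZMod p) V) := ⟨F, hmem⟩
  exact Module.Finite.of_basis v

/-- If `(ℤ/pℤ)^K` is small with respect to a group having an element of order `p`, then `K`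
is finite. -/
theorem finite_of_isBSmall_pi_zmod {p : ℕ} [Fact p.Prime] {K : Type} {B : Type*}
    [AddCommGroup B] (h : IsBSmall (K → ZMod p) B) {b : B} (hb : addOrderOf b = p) :
    Finite K := by
  classical
  have := h.finite_of_addOrderOf_eq hb
  exact (Pi.linearIndependent_single_one K (ZMod p)).finite


/-- Let `p` be a prime, `P` a nonzero abelian `p`-group, `R` a nonzero
torsion abelian group and `κ` a cardinal (realized as a type `K`). Then
(1) `(ℤ/pℤ)^κ` (direct product) is `P`-small iff `κ` is finite, and
(2) `ℤ^κ` (direct product) is `R`-small iff `κ` is finite. -/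
theorem prod_zmod_int_small_iff_finite (p : ℕ) (hp : p.Prime)
    (P R : Type) [AddCommGroup P] [AddCommGroup R]
    (hPnt : Nontrivial P) (hPp : ∀ x : P, ∃ n : ℕ, p ^ n • x = 0)
    (hRnt : Nontrivial R) (hRt : AddMonoid.IsTorsion R)
    (K : Type) :
    (IsBSmall (K → ZMod p) P ↔ Finite K) ∧ (IsBSmall (K → ℤ) R ↔ Finite K) := by
  have : Fact p.Prime := ⟨hp⟩
  refine ⟨⟨fun h => ?_, fun _ => .of_fg inferInstance⟩,
    ⟨fun h => ?_, fun _ => .of_fg (Module.Finite.iff_addGroup_fg.1 inferInstance)⟩⟩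
  · obtain ⟨x, hx⟩ := exists_ne (0 : P)
    obtain ⟨n, hn⟩ := hPp x
    have hdvd : addOrderOf x ∣ p ^ n := addOrderOf_dvd_of_nsmul_eq_zero hn
    have hpx : p ∣ addOrderOf x := by
      obtain ⟨m, -, hm⟩ := (Nat.dvd_prime_pow hp).1 hdvd
      rw [hm]
      refine dvd_pow_self p ?_
      rintro rfl
      exact hx (AddMonoid.addOrderOf_eq_one_iff.1 (by simpa using hm))
    exact finite_of_isBSmall_pi_zmod h
      (addOrderOf_nsmul_addOrderOf_sub (ne_zero_of_dvd_ne_zero (pow_ne_zero n hp.ne_zero) hdvd)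
        hpx)
  · obtain ⟨x, hx⟩ := exists_ne (0 : R)
    have hne : addOrderOf x ≠ 1 := fun h1 => hx (AddMonoid.addOrderOf_eq_one_iff.1 h1)
    have : Fact (addOrderOf x).minFac.Prime := ⟨Nat.minFac_prime hne⟩
    refine finite_of_isBSmall_pi_zmod
      (h.of_surjective ((Int.castAddHom (ZMod (addOrderOf x).minFac)).compLeft K) ?_)
      (addOrderOf_nsmul_addOrderOf_sub (hRt x).addOrderOf_pos.ne' (Nat.minFac_dvd _))
    exact (ZMod.intCast_surjective).comp_left
end
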